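/- Let n ≥ 1 be an integer and k a nonzero commutative ring. The following are equivalent: (1) the group algebra k[ℤ/n] is isomorphic as a k-algebra to k^n; (2) the polynomial X^n − 1 ∈ k[X] factors as a product of monic degree-1 polynomials that are pairwise comaximal; (3) n is invertible in k and the n-th cyclotomic polynomial Φ_n has a root in k. -/

import Mathlib

open Polynomial in
theorem aux_isUnit_sub {k : Type*} [CommRing k] {a b : k}
    (h : IsCoprime (X - C a) (X - C b)) : IsUnit (a - b) := by
  obtain ⟨u, v, h⟩ := h
  have := congrArg (eval a) h
  simp at this
  exact IsUnit.of_mul_eq_one_right _ this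

open Polynomial in
theorem aux_prod {k : Type*} [CommRing k] [Nontrivial k] (n : ℕ) (hn : 0 < n) (a : Fin n → k)
    (h1 : ∀ i, a i ^ n = 1) (h2 : ∀ i j, i ≠ j → IsUnit (a i - a j)) :
    (X ^ n - 1 : k[X]) = ∏ i, (X - C (a i)) ∧
      ∀ i j, i ≠ j → IsCoprime (X - C (a i)) (X - C (a j)) := by
  have hc : ∀ i j, i ≠ j → IsCoprime (X - C (a i)) (X - C (a j)) :=
    fun i j hij => isCoprime_X_sub_C_of_isUnit_sub (h2 i j hij)
  refine ⟨?_, hc⟩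
  have hm : (X ^ n - 1 : k[X]).Monic := by
    simpa using monic_X_pow_sub_C (1 : k) hn.ne'
  have hd : (X ^ n - 1 : k[X]).natDegree = n := by
    simpa using natDegree_X_pow_sub_C (n := n) (r := (1 : k))
  refine eq_of_monic_of_dvd_of_natDegree_le
    (monic_prod_of_monic _ _ fun i _ => monic_X_sub_C (a i)) hm ?_ ?_
  · apply Finset.prod_dvd_of_coprime
    · intro i _ j _ hij
      exact hc i j hij
    · intro i _
      rw [dvd_iff_isRoot]
      simp [h1]
  · rw [hd, natDegree_prod_of_monic _ _ fun i _ => monic_X_sub_C (a i)]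
    simp

/-- The character sending the generator to `g`. -/
def auxHom {A : Type*} [Monoid A] (n : ℕ) (hn : 0 < n) (g : A) (hg : g ^ n = 1) :
    Multiplicative (ZMod n) →* A where
  toFun x := g ^ (ZMod.val x.toAdd)
  map_one' := by
    have : NeZero n := ⟨hn.ne'⟩
    simp
  map_mul' x y := by
    have : NeZero n := ⟨hn.ne'⟩
    rw [toAdd_mul, ZMod.val_add, ← pow_add, ← pow_eq_pow_mod _ hg]

open Polynomial in
theorem aux_gen {k : Type*} [CommRing k] (n : ℕ) (hn : 0 < n)
    (x : MonoidAlgebra k (Multiplicative (ZMod n))) :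
    ∃ p : k[X], aeval (MonoidAlgebra.of k _ (Multiplicative.ofAdd (1 : ZMod n))) p = x := by
  have : NeZero n := ⟨hn.ne'⟩
  induction x using MonoidAlgebra.induction_on with
  | of g =>
    refine ⟨X ^ (ZMod.val g.toAdd), ?_⟩
    rw [map_pow, aeval_X, ← map_pow, ← ofAdd_nsmul]
    simp
  | add f g hf hg =>
    obtain ⟨p, rfl⟩ := hf
    obtain ⟨q, rfl⟩ := hg
    exact ⟨p + q, map_add _ _ _⟩
  | smul r f hf =>
    obtain ⟨p, rfl⟩ := hf
    exact ⟨r • p, map_smul _ _ _⟩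

open Polynomial in
theorem aux12 {k : Type*} [CommRing k] (n : ℕ) (hn : 0 < n)
    (φ : MonoidAlgebra k (Multiplicative (ZMod n)) ≃ₐ[k] (Fin n → k)) :
    ∃ a : Fin n → k, (∀ i, a i ^ n = 1) ∧ ∀ i j, i ≠ j → IsUnit (a i - a j) := by
  set g := MonoidAlgebra.of k _ (Multiplicative.ofAdd (1 : ZMod n)) with hg
  have hgn : g ^ n = 1 := by
    rw [hg, ← map_pow, ← ofAdd_nsmul, nsmul_one, ZMod.natCast_self, ofAdd_zero, map_one]
  refine ⟨φ g, ?_, ?_⟩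
  · intro i
    rw [← Pi.pow_apply, ← map_pow, hgn, map_one, Pi.one_apply]
  · intro i j hij
    obtain ⟨p, hp⟩ := aux_gen n hn (φ.symm (Pi.single i 1))
    have h2 : aeval (φ g) p = Pi.single i 1 := by
      have := congrArg φ hp
      rw [AlgEquiv.apply_symm_apply, ← hg] at this
      rw [← this]
      exact aeval_algHom_apply φ.toAlgHom g p
    have key : ∀ l, eval (φ g l) p = (Pi.single i 1 : Fin n → k) l := by
      intro l
      rw [← h2, ← coe_aeval_eq_eval]
      exact aeval_algHom_apply (Pi.evalAlgHom k (fun _ : Fin n => k) l) (φ g) p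
    have hd := sub_dvd_eval_sub (φ g i) (φ g j) p
    rw [key i, key j, Pi.single_eq_same, Pi.single_eq_of_ne hij.symm, sub_zero] at hd
    exact isUnit_of_dvd_one hd

theorem aux21 {k : Type*} [CommRing k] [Nontrivial k] (n : ℕ) (hn : 0 < n) (a : Fin n → k)
    (h1 : ∀ i, a i ^ n = 1) (h2 : ∀ i j, i ≠ j → IsUnit (a i - a j)) :
    Nonempty (MonoidAlgebra k (Multiplicative (ZMod n)) ≃ₐ[k] (Fin n → k)) := by
  classical
  have : NeZero n := ⟨hn.ne'⟩
  have ha : a ^ n = 1 := funext h1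
  let F : MonoidAlgebra k (Multiplicative (ZMod n)) →ₐ[k] (Fin n → k) :=
    MonoidAlgebra.lift k _ _ (auxHom n hn a ha)
  have haF : a ∈ F.range := by
    by_cases hn1 : n = 1
    · refine ⟨1, ?_⟩
      subst hn1
      rw [map_one]
      simpa using ha.symm
    · refine ⟨MonoidAlgebra.of k _ (Multiplicative.ofAdd (1 : ZMod n)), ?_⟩
      have : Fact (1 < n) := ⟨by omega⟩
      change F _ = _
      simp only [F, MonoidAlgebra.lift_of]
      simp [auxHom, ZMod.val_one]
  have hs : ∀ i, Pi.single i (1 : k) ∈ F.range := by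
    intro i
    have hprod : ∏ j ∈ Finset.univ.erase i, (a - algebraMap k (Fin n → k) (a j)) ∈ F.range :=
      Subalgebra.prod_mem _ fun j _ => Subalgebra.sub_mem _ haF (Subalgebra.algebraMap_mem _ _)
    have hu : IsUnit (∏ j ∈ Finset.univ.erase i, (a i - a j)) := by
      rw [IsUnit.prod_iff]
      intro j hj
      exact h2 i j (Finset.ne_of_mem_erase hj).symm
    obtain ⟨u, hu⟩ := hu
    have := Subalgebra.smul_mem _ hprod (↑u⁻¹ : k)
    convert this using 1
    funext l
    by_cases hl : l = i
    · subst hl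
      simp [Finset.prod_apply, ← hu]
    · rw [Pi.single_eq_of_ne hl, Pi.smul_apply, Finset.prod_apply,
        Finset.prod_eq_zero (i := l) (by simp [hl]) (by simp), smul_zero]
  have hsurj : Function.Surjective F := by
    intro x
    have : x ∈ F.range := by
      have hx : x = ∑ i, x i • Pi.single i (1 : k) := by
        funext l
        simp [Finset.sum_apply, Pi.single_apply]
      rw [hx]
      exact Subalgebra.sum_mem _ fun i _ => Subalgebra.smul_mem _ (hs i) _
    exact this
  let e : MonoidAlgebra k (Multiplicative (ZMod n)) ≃ₗ[k] (Fin n → k) :=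
    (MonoidAlgebra.coeffLinearEquiv k).trans
    ((Finsupp.linearEquivFunOnFinite k k (Multiplicative (ZMod n))).trans
      (LinearEquiv.funCongrLeft k k
        (((Multiplicative.toAdd).trans (ZMod.finEquiv n).symm.toEquiv).symm)))
  have hinj : Function.Injective F := by
    have := OrzechProperty.injective_of_surjective_of_injective (R := k)
      e.toLinearMap F.toLinearMap e.injective hsurj
    exact this
  exact ⟨AlgEquiv.ofBijective F ⟨hinj, hsurj⟩⟩

open Polynomial in
theorem aux32 {k : Type*} [CommRing k] (n : ℕ) (hn : 0 < n)
    (hu : IsUnit (n : k)) (α : k) (hα : (cyclotomic n k).eval α = 0) :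
    ∃ a : Fin n → k, (∀ i, a i ^ n = 1) ∧ ∀ i j, i ≠ j → IsUnit (a i - a j) := by
  have hα1 : α ^ n = 1 := by
    obtain ⟨q, hq⟩ := cyclotomic.dvd_X_pow_sub_one n k
    have := congrArg (eval α) hq
    simp [hα] at this
    exact sub_eq_zero.mp this
  refine ⟨fun i => α ^ (i : ℕ), ?_, ?_⟩
  · intro i
    rw [← pow_mul, mul_comm, pow_mul, hα1, one_pow]
  · intro i j hij
    by_contra hnu
    obtain ⟨M, hM, hmem⟩ := exists_max_ideal_of_mem_nonunits hnu
    let := Ideal.Quotient.field M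
    have hne : ((n : ℕ) : k ⧸ M) ≠ 0 := by
      have := hu.map (Ideal.Quotient.mk M)
      simpa using this.ne_zero
    have : NeZero ((n : ℕ) : k ⧸ M) := ⟨hne⟩
    have hroot : IsRoot (cyclotomic n (k ⧸ M)) (Ideal.Quotient.mk M α) := by
      rw [IsRoot, ← map_cyclotomic n (Ideal.Quotient.mk M), eval_map, eval₂_hom, hα, map_zero]
    have hp := isRoot_cyclotomic_iff.mp hroot
    have h0 := Ideal.Quotient.eq_zero_iff_mem.mpr hmem
    rw [map_sub, map_pow, map_pow, sub_eq_zero] at h0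
    exact hij (Fin.ext (hp.pow_inj i.2 j.2 h0))

open Polynomial in
theorem aux_idem {k : Type*} [CommRing k] {e : k} (he : e * e = e) (P : k[X]) (u v : k) :
    P.eval (e * u + (1 - e) * v) = e * P.eval u + (1 - e) * P.eval v := by
  induction P using Polynomial.induction_on with
  | C a => simp; ring
  | add p q hp hq => simp only [eval_add, hp, hq]; ring
  | monomial m a h =>
    have : (C a * X ^ (m + 1) : k[X]) = (C a * X ^ m) * X := by ring
    rw [this]
    simp only [eval_mul_X, h]
    linear_combination (eval u (C a * X ^ m) - eval v (C a * X ^ m)) * (u - v) * he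

open Polynomial in
theorem aux_nil {k : Type*} [CommRing k] (n : ℕ) (hn : 0 < n) (a : Fin n → k)
    (h : (X ^ n - 1 : k[X]) = ∏ i, (X - C (a i))) :
    IsNilpotent (∏ i, (cyclotomic n k).eval (a i)) := by
  rw [← mem_nilradical, nilradical_eq_sInf, Ideal.mem_sInf]
  intro p hp
  have hp : p.IsPrime := hp
  let K := FractionRing (k ⧸ p)
  let f : k →+* K := (algebraMap (k ⧸ p) K).comp (Ideal.Quotient.mk p)
  have h' : (X ^ n - 1 : K[X]) = ∏ i, (X - C (f (a i))) := by
    have := congrArg (Polynomial.map f) h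
    simpa [Polynomial.map_prod] using this
  have hs : (X ^ n - 1 : K[X]).Splits := by
    rw [h']
    exact Splits.prod fun i _ => Splits.X_sub_C _
  have hne : (X ^ n - 1 : K[X]) ≠ 0 := by
    simpa using (monic_X_pow_sub_C (1 : K) hn.ne').ne_zero
  have hs2 := hs.of_dvd hne (cyclotomic.dvd_X_pow_sub_one n K)
  obtain ⟨r, hr⟩ := hs2.exists_eval_eq_zero (degree_cyclotomic_pos n K hn).ne'
  obtain ⟨q, hq⟩ := cyclotomic.dvd_X_pow_sub_one n K
  have h0 : eval r (∏ i, (X - C (f (a i)))) = 0 := by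
    rw [← h', hq, eval_mul, hr, zero_mul]
  rw [eval_prod, Finset.prod_eq_zero_iff] at h0
  obtain ⟨i, _, hi⟩ := h0
  have hri : r = f (a i) := by simpa [sub_eq_zero] using hi
  have hz : f ((cyclotomic n k).eval (a i)) = 0 := by
    rw [← eval₂_hom, ← eval_map, map_cyclotomic, ← hri, hr]
  have hz' : Ideal.Quotient.mk p ((cyclotomic n k).eval (a i)) = 0 :=
    (IsFractionRing.injective (k ⧸ p) K) (by rw [map_zero]; exact hz)
  exact Ideal.mem_of_dvd _ (Finset.dvd_prod_of_mem _ (Finset.mem_univ i))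
    (Ideal.Quotient.eq_zero_iff_mem.mp hz')

open Polynomial in
theorem aux23 {k : Type*} [CommRing k] (n : ℕ) (hn : 0 < n) (a : Fin n → k)
    (h : (X ^ n - 1 : k[X]) = ∏ i, (X - C (a i)))
    (h2 : ∀ i j, i ≠ j → IsUnit (a i - a j)) (h1 : ∀ i, a i ^ n = 1) :
    IsUnit (n : k) ∧ ∃ α : k, (cyclotomic n k).eval α = 0 := by
  classical
  have hu : IsUnit (n : k) := by
    let i : Fin n := ⟨0, hn⟩
    have hd := congrArg (fun P => eval (a i) (derivative P)) h
    simp only [← Finset.mul_prod_erase Finset.univ (fun i => X - C (a i)) (Finset.mem_univ i)] at hd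
    simp [eval_prod] at hd
    have : IsUnit (∏ j ∈ Finset.univ.erase i, (a i - a j)) := by
      rw [IsUnit.prod_iff]
      intro j hj
      exact h2 i j (Finset.ne_of_mem_erase hj).symm
    rw [← hd, derivative_X_pow, eval_mul, eval_C] at this
    exact isUnit_of_mul_isUnit_left this
  refine ⟨hu, ?_⟩
  obtain ⟨Ψ, hΨ⟩ := cyclotomic.dvd_X_pow_sub_one n k
  have hsep : (X ^ n - 1 : k[X]).Separable := by
    simpa using separable_X_pow_sub_C_unit (1 : kˣ) hu
  rw [hΨ] at hsep
  obtain ⟨A, B, hAB⟩ := hsep.isCoprime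
  have hz : ∀ u : k, u ^ n = 1 → eval u (cyclotomic n k) * eval u Ψ = 0 := by
    intro u hu
    rw [← eval_mul, ← hΨ]
    simp [hu]
  have hone : ∀ u : k, eval u A * eval u (cyclotomic n k) + eval u B * eval u Ψ = 1 := by
    intro u
    have := congrArg (eval u) hAB
    simpa using this
  have key : ∀ s : Finset (Fin n), ∃ w : k, w ^ n = 1 ∧
      ∏ i ∈ s, (cyclotomic n k).eval (a i) ∣ (cyclotomic n k).eval w := by
    intro s
    induction s using Finset.induction_on with
    | empty => exact ⟨1, one_pow _, by simp⟩
    | insert i s hi ih =>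
      obtain ⟨v, hv1, hv2⟩ := ih
      have e1 := hz (a i) (h1 i)
      have e2 := hone (a i)
      set x := eval (a i) (cyclotomic n k)
      set y := eval (a i) Ψ
      set c := eval (a i) A
      set d := eval (a i) B
      have he : (d * y) * (d * y) = d * y := by
        linear_combination (d * y) * e2 - c * d * e1
      refine ⟨(d * y) * a i + (1 - d * y) * v, ?_, ?_⟩
      · have := aux_idem he (X ^ n) (a i) v
        simp only [eval_pow, eval_X, h1, hv1] at this
        rw [this]; ring
      · rw [aux_idem he, Finset.prod_insert hi]
        have : d * y * eval (a i) (cyclotomic n k) + (1 - d * y) * eval v (cyclotomic n k)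
            = x * eval v (cyclotomic n k) * c := by
          change d * y * x + _ = _
          linear_combination d * e1 - eval v (cyclotomic n k) * e2
        rw [this]
        exact Dvd.dvd.mul_right (mul_dvd_mul_left x hv2) c
  obtain ⟨w, hw1, hw2⟩ := key Finset.univ
  have hnil : IsNilpotent (eval w (cyclotomic n k)) := by
    obtain ⟨q, hq⟩ := hw2
    rw [hq]
    exact (Commute.all _ _).isNilpotent_mul_right (aux_nil n hn a h)
  refine ⟨w, ?_⟩
  have e1 := hz w hw1
  have e2 := hone w
  have hunit : IsUnit (eval w B * eval w Ψ) := by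
    have h3 : eval w B * eval w Ψ = 1 - eval w A * eval w (cyclotomic n k) := by
      linear_combination e2
    rw [h3]
    exact ((Commute.all _ _).isNilpotent_mul_left hnil).isUnit_one_sub
  have hu2 := isUnit_of_mul_isUnit_right hunit
  exact (hu2.mul_left_eq_zero).mp e1

theorem stmt_10 {k : Type*} [CommRing k] [Nontrivial k] (n : ℕ) (hn : 0 < n) :
    List.TFAE
      [ Nonempty (MonoidAlgebra k (Multiplicative (ZMod n)) ≃ₐ[k] (Fin n → k)),
        ∃ a : Fin n → k,
          (Polynomial.X ^ n - 1 : Polynomial k) = ∏ i, (Polynomial.X - Polynomial.C (a i)) ∧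
          ∀ i j, i ≠ j →
            IsCoprime (Polynomial.X - Polynomial.C (a i)) (Polynomial.X - Polynomial.C (a j)),
        IsUnit (n : k) ∧ ∃ α : k, (Polynomial.cyclotomic n k).eval α = 0 ] := by
  have hpow : ∀ a : Fin n → k,
      (Polynomial.X ^ n - 1 : Polynomial k) = ∏ i, (Polynomial.X - Polynomial.C (a i)) →
      ∀ i, a i ^ n = 1 := by
    intro a h i
    have := congrArg (Polynomial.eval (a i)) h
    rw [Polynomial.eval_prod, Finset.prod_eq_zero (Finset.mem_univ i) (by simp)] at this
    simpa [sub_eq_zero] using this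
  tfae_have 1 → 2 := by
    rintro ⟨φ⟩
    obtain ⟨a, h1, h2⟩ := aux12 n hn φ
    exact ⟨a, aux_prod n hn a h1 h2⟩
  tfae_have 2 → 1 := by
    rintro ⟨a, h, hc⟩
    exact aux21 n hn a (hpow a h) fun i j hij => aux_isUnit_sub (hc i j hij)
  tfae_have 2 → 3 := by
    rintro ⟨a, h, hc⟩
    exact aux23 n hn a h (fun i j hij => aux_isUnit_sub (hc i j hij)) (hpow a h)
  tfae_have 3 → 2 := by
    rintro ⟨hu, α, hα⟩
    obtain ⟨a, h1, h2⟩ := aux32 n hn hu α hα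
    exact ⟨a, aux_prod n hn a h1 h2⟩
  tfae_finish
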